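/- arXiv:1106.3264 — 6 statements merged into one kernel-verified Lean document; each statement's English description precedes it below -/
import Mathlib

section
/- Let A(z_1,z_2;q) be a zero-weight, unitary dynamical matrix on V⊗V satisfying (YB-A), and let f : ℂ → ℂ be any function. Define B, C, D entrywise by D_{(i,j),(k,l)}(z_1,z_2;q) = A_{(l,k),(j,i)}(f(z_2),f(z_1); q+μ(e_i+e_j)), C_{(i,j),(k,l)}(z_1,z_2;q) = A_{(l,i),(j,k)}(f(z_2),z_1; q+μ e_l), and B_{(i,j),(k,l)}(z_1,z_2;q) = A_{(k,j),(i,l)}(f(z_1),z_2; q+μ e_k). Then: (1) B_{12}(z_1,z_2;q) = C_{21}(z_2,z_1;q) (where C_{21} = P C_{12} P with P the flip); (2) D is unitary; (3) the quadruple (A,B,C,D) satisfies (YB-D), (YB-AC) and (YB-DB). -/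
open scoped BigOperators

noncomputable section

namespace Paper

/-- Dynamical parameter space: `q : ℂ^n`. -/
abbrev Qn (n : ℕ) := Fin n → ℂ

/-- `End(V ⊗ V)` with `V = ℂ^n`, as matrices indexed by pairs. -/
abbrev DM (n : ℕ) := Matrix (Fin n × Fin n) (Fin n × Fin n) ℂ

/-- Index set for `V ⊗ V ⊗ V`. -/
abbrev I3 (n : ℕ) := Fin n × Fin n × Fin n

/-- Matrices on `V ⊗ V ⊗ V` with entries in `R`. -/
abbrev M3 (n : ℕ) (R : Type*) := Matrix (I3 n) (I3 n) R

/-- Standard basis vector `e i` of `ℂ^n`. -/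
def ee (n : ℕ) (i : Fin n) : Qn n := fun k => if k = i then 1 else 0

/-- Embedding of a (spectator-dependent) two-site matrix into sites 1,2 of
`V ⊗ V ⊗ V`; the argument of `X` is the index of the (spectator) third site. -/
def pl12 {n : ℕ} {R : Type*} [Zero R] (X : Fin n → Matrix (Fin n × Fin n) (Fin n × Fin n) R) :
    M3 n R :=
  Matrix.of fun p p' =>
    if p.2.2 = p'.2.2 then X p.2.2 (p.1, p.2.1) (p'.1, p'.2.1) else 0

/-- Embedding into sites 1,3; the spectator is the second site. -/
def pl13 {n : ℕ} {R : Type*} [Zero R] (X : Fin n → Matrix (Fin n × Fin n) (Fin n × Fin n) R) :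
    M3 n R :=
  Matrix.of fun p p' =>
    if p.2.1 = p'.2.1 then X p.2.1 (p.1, p.2.2) (p'.1, p'.2.2) else 0

/-- Embedding into sites 2,3; the spectator is the first site. -/
def pl23 {n : ℕ} {R : Type*} [Zero R] (X : Fin n → Matrix (Fin n × Fin n) (Fin n × Fin n) R) :
    M3 n R :=
  Matrix.of fun p p' =>
    if p.1 = p'.1 then X p.1 (p.2.1, p.2.2) (p'.2.1, p'.2.2) else 0

/-- Conjugation by the flip `P`: `(P M P)_{(i,j),(k,l)} = M_{(j,i),(l,k)}`. -/
def swapDM {n : ℕ} {R : Type*} (M : Matrix (Fin n × Fin n) (Fin n × Fin n) R) :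
    Matrix (Fin n × Fin n) (Fin n × Fin n) R :=
  Matrix.of fun p p' => M (p.2, p.1) (p'.2, p'.1)

/-- A dynamical matrix with two spectral parameters. -/
abbrev SDM (n : ℕ) := ℂ → ℂ → Qn n → DM n

/-- Zero-weight condition: entries vanish unless `e_i + e_j = e_k + e_l`. -/
def ZeroWeight {n : ℕ} (A : SDM n) : Prop :=
  ∀ z1 z2 q i j k l, ee n i + ee n j ≠ ee n k + ee n l → A z1 z2 q (i, j) (k, l) = 0

/-- Weight condition for `B`/`C`: entries vanish unless `e_i - e_j = e_k - e_l`. -/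
def BCWeight {n : ℕ} (B : SDM n) : Prop :=
  ∀ z1 z2 q i j k l, ee n i - ee n j ≠ ee n k - ee n l → B z1 z2 q (i, j) (k, l) = 0

/-- Unitarity: `A₁₂(z₁,z₂;q) A₂₁(z₂,z₁;q) = Id`. -/
def Unitary {n : ℕ} (A : SDM n) : Prop :=
  ∀ z1 z2 q, A z1 z2 q * swapDM (A z2 z1 q) = 1

/-- (YB-A): `A₁₂(q) A₁₃(q-h²) A₂₃(q) = A₂₃(q-h¹) A₁₃(q) A₁₂(q-h³)`. -/
def YBA {n : ℕ} (μ : ℂ) (A : SDM n) : Prop :=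
  ∀ z1 z2 z3 q,
    pl12 (fun _ => A z1 z2 q) * pl13 (fun m => A z1 z3 (q - μ • ee n m)) *
        pl23 (fun _ => A z2 z3 q) =
      pl23 (fun m => A z2 z3 (q - μ • ee n m)) * pl13 (fun _ => A z1 z3 q) *
        pl12 (fun m => A z1 z2 (q - μ • ee n m))

/-- (YB-D): `D₁₂(q+h³) D₁₃(q) D₂₃(q+h¹) = D₂₃(q) D₁₃(q+h²) D₁₂(q)`. -/
def YBD {n : ℕ} (μ : ℂ) (D : SDM n) : Prop :=
  ∀ z1 z2 z3 q,
    pl12 (fun m => D z1 z2 (q + μ • ee n m)) * pl13 (fun _ => D z1 z3 q) *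
        pl23 (fun m => D z2 z3 (q + μ • ee n m)) =
      pl23 (fun _ => D z2 z3 q) * pl13 (fun m => D z1 z3 (q + μ • ee n m)) *
        pl12 (fun _ => D z1 z2 q)

/-- (YB-AC): `A₁₂(q) C₁₃(q-h²) C₂₃(q) = C₂₃(q-h¹) C₁₃(q) A₁₂(q+h³)`. -/
def YBAC {n : ℕ} (μ : ℂ) (A C : SDM n) : Prop :=
  ∀ z1 z2 z3 q,
    pl12 (fun _ => A z1 z2 q) * pl13 (fun m => C z1 z3 (q - μ • ee n m)) *
        pl23 (fun _ => C z2 z3 q) =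
      pl23 (fun m => C z2 z3 (q - μ • ee n m)) * pl13 (fun _ => C z1 z3 q) *
        pl12 (fun m => A z1 z2 (q + μ • ee n m))

/-- (YB-DB): `D₁₂(q-h³) B₁₃(q) B₂₃(q+h¹) = B₂₃(q) B₁₃(q+h²) D₁₂(q)`. -/
def YBDB {n : ℕ} (μ : ℂ) (D B : SDM n) : Prop :=
  ∀ z1 z2 z3 q,
    pl12 (fun m => D z1 z2 (q - μ • ee n m)) * pl13 (fun _ => B z1 z3 q) *
        pl23 (fun m => B z2 z3 (q + μ • ee n m)) =
      pl23 (fun _ => B z2 z3 q) * pl13 (fun m => B z1 z3 (q + μ • ee n m)) *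
        pl12 (fun _ => D z1 z2 q)

/-- `C₁₂(z₁,z₂;q) = B₂₁(z₂,z₁;q)`. -/
def CisB21 {n : ℕ} (B C : SDM n) : Prop :=
  ∀ z1 z2 q, C z1 z2 q = swapDM (B z2 z1 q)

/-- `K₁` on `V ⊗ V` (values in `R`), with spectator-dependent argument:
the argument of `X` is the index of the second (spectator) site. -/
def op1 {n : ℕ} {R : Type*} [Zero R] (X : Fin n → Matrix (Fin n) (Fin n) R) :
    Matrix (Fin n × Fin n) (Fin n × Fin n) R :=
  Matrix.of fun p p' => if p.2 = p'.2 then X p.2 p.1 p'.1 else 0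

/-- `K₂` on `V ⊗ V`, the spectator being the first site. -/
def op2 {n : ℕ} {R : Type*} [Zero R] (X : Fin n → Matrix (Fin n) (Fin n) R) :
    Matrix (Fin n × Fin n) (Fin n × Fin n) R :=
  Matrix.of fun p p' => if p.1 = p'.1 then X p.1 p.2 p'.2 else 0

/-- Scalar structure matrices viewed with entries in an algebra `R`. -/
def sc {n : ℕ} {R : Type*} [Semiring R] [Algebra ℂ R] (M : DM n) :
    Matrix (Fin n × Fin n) (Fin n × Fin n) R :=
  M.map (algebraMap ℂ R)

/-- The dynamical reflection equation (RE) for a matrix `K` of functions with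
values in a `ℂ`-algebra `R`:
`A₁₂(q) K₁(q-h²) B₁₂(q) K₂(q+h¹) = K₂(q-h¹) C₁₂(q) K₁(q+h²) D₁₂(q)`. -/
def RE {n : ℕ} {R : Type*} [Semiring R] [Algebra ℂ R] (μ : ℂ) (A B C D : SDM n)
    (K : ℂ → Qn n → Matrix (Fin n) (Fin n) R) : Prop :=
  ∀ z1 z2 q,
    sc (A z1 z2 q) * op1 (fun m => K z1 (q - μ • ee n m)) * sc (B z1 z2 q) *
        op2 (fun m => K z2 (q + μ • ee n m)) =
      op2 (fun m => K z2 (q - μ • ee n m)) * sc (C z1 z2 q) *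
        op1 (fun m => K z1 (q + μ • ee n m)) * sc (D z1 z2 q)

/-- The `D` matrix built from `A` in Theorem 3.3:
`D_{(i,j),(k,l)}(z₁,z₂;q) = A_{(l,k),(j,i)}(f z₂, f z₁; q + μ(e_i+e_j))`. -/
def Dmat {n : ℕ} (μ : ℂ) (f : ℂ → ℂ) (A : SDM n) : SDM n := fun z1 z2 q =>
  Matrix.of fun p p' =>
    A (f z2) (f z1) (q + μ • (ee n p.1 + ee n p.2))  (p'.2, p'.1) (p.2, p.1)

/-- `C_{(i,j),(k,l)}(z₁,z₂;q) = A_{(l,i),(j,k)}(f z₂, z₁; q + μ e_l)`. -/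
def Cmat {n : ℕ} (μ : ℂ) (f : ℂ → ℂ) (A : SDM n) : SDM n := fun z1 z2 q =>
  Matrix.of fun p p' =>
    A (f z2) z1 (q + μ • ee n p'.2)  (p'.2, p.1) (p.2, p'.1)

/-- `B_{(i,j),(k,l)}(z₁,z₂;q) = A_{(k,j),(i,l)}(f z₁, z₂; q + μ e_k)`. -/
def Bmat {n : ℕ} (μ : ℂ) (f : ℂ → ℂ) (A : SDM n) : SDM n := fun z1 z2 q =>
  Matrix.of fun p p' =>
    A (f z1) z2 (q + μ • ee n p'.1)  (p'.1, p.2) (p.1, p'.2)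


/-- Entries of a product `X₁₂ Y₁₃ Z₂₃`. -/
theorem pl12_mul_pl13_mul_pl23_apply {n : ℕ} (X Y Z : Fin n → DM n) (i j k l m r : Fin n) :
    (pl12 X * pl13 Y * pl23 Z) (i, j, k) (l, m, r) =
      ∑ a, ∑ b, ∑ c, X k (i, j) (a, b) * Y b (a, k) (l, c) * Z l (b, c) (m, r) := by
  have h : ∀ a b c, (pl12 X * pl13 Y) (i, j, k) (a, b, c) =
      ∑ d, X k (i, j) (d, b) * Y b (d, k) (a, c) := by
    intro a b c
    simp [Matrix.mul_apply, Fintype.sum_prod_type, pl12, pl13, mul_ite, ite_mul]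
  rw [Matrix.mul_apply]
  simp only [Fintype.sum_prod_type, h]
  simp only [pl23, Matrix.of_apply, mul_ite, mul_zero, Finset.sum_ite_irrel, Finset.sum_const_zero,
    Finset.sum_ite_eq', Finset.mem_univ, if_true, Finset.sum_mul]
  rw [Finset.sum_congr rfl fun b _ => Finset.sum_comm, Finset.sum_comm]

/-- Entries of a product `X₂₃ Y₁₃ Z₁₂`. -/
theorem pl23_mul_pl13_mul_pl12_apply {n : ℕ} (X Y Z : Fin n → DM n) (i j k l m r : Fin n) :
    (pl23 X * pl13 Y * pl12 Z) (i, j, k) (l, m, r) =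
      ∑ a, ∑ b, ∑ c, X i (j, k) (b, c) * Y b (i, c) (a, r) * Z r (a, b) (l, m) := by
  have h : ∀ a b c, (pl23 X * pl13 Y) (i, j, k) (a, b, c) =
      ∑ d, X i (j, k) (b, d) * Y b (i, d) (a, c) := by
    intro a b c
    simp [Matrix.mul_apply, Fintype.sum_prod_type, pl23, pl13, mul_ite, ite_mul,
      Finset.sum_ite_irrel]
  rw [Matrix.mul_apply]
  simp only [Fintype.sum_prod_type, h]
  simp only [pl12, Matrix.of_apply, mul_ite, mul_zero,
    Finset.sum_ite_eq', Finset.mem_univ, if_true, Finset.sum_mul]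

/-- The dynamical Yang–Baxter equation (YB-A) in components. -/
theorem YBA.apply {n : ℕ} {μ : ℂ} {A : SDM n} (hYB : YBA μ A) (z1 z2 z3 : ℂ) (q : Qn n)
    (i j k l m r : Fin n) :
    ∑ a, ∑ b, ∑ c, A z1 z2 q (i, j) (a, b) * A z1 z3 (q - μ • ee n b) (a, k) (l, c) *
        A z2 z3 q (b, c) (m, r) =
      ∑ a, ∑ b, ∑ c, A z2 z3 (q - μ • ee n i) (j, k) (b, c) * A z1 z3 q (i, c) (a, r) *
        A z1 z2 (q - μ • ee n r) (a, b) (l, m) := by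
  rw [← pl12_mul_pl13_mul_pl23_apply (fun _ => A z1 z2 q) (fun b => A z1 z3 (q - μ • ee n b))
      (fun _ => A z2 z3 q), hYB z1 z2 z3 q, pl23_mul_pl13_mul_pl12_apply]

/-- For a zero-weight matrix, the dynamical parameters in a product of three entries may be
changed as soon as they agree under the assumption that all three weights are conserved. -/
theorem ZeroWeight.mul_mul_congr {n : ℕ} {A : SDM n} (hZW : ZeroWeight A)
    {z1 w1 z2 w2 z3 w3 : ℂ} {q1 q2 q3 r1 r2 r3 : Qn n}
    {i1 j1 k1 l1 i2 j2 k2 l2 i3 j3 k3 l3 : Fin n}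
    (h : ee n i1 + ee n j1 = ee n k1 + ee n l1 → ee n i2 + ee n j2 = ee n k2 + ee n l2 →
      ee n i3 + ee n j3 = ee n k3 + ee n l3 → q1 = r1 ∧ q2 = r2 ∧ q3 = r3) :
    A z1 w1 q1 (i1, j1) (k1, l1) * A z2 w2 q2 (i2, j2) (k2, l2) * A z3 w3 q3 (i3, j3) (k3, l3) =
      A z1 w1 r1 (i1, j1) (k1, l1) * A z2 w2 r2 (i2, j2) (k2, l2) *
        A z3 w3 r3 (i3, j3) (k3, l3) := by
  by_cases h1 : ee n i1 + ee n j1 = ee n k1 + ee n l1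
  swap
  · simp [hZW _ _ _ _ _ _ _ h1]
  by_cases h2 : ee n i2 + ee n j2 = ee n k2 + ee n l2
  swap
  · simp [hZW _ _ _ _ _ _ _ h2]
  by_cases h3 : ee n i3 + ee n j3 = ee n k3 + ee n l3
  swap
  · simp [hZW _ _ _ _ _ _ _ h3]
  obtain ⟨rfl, rfl, rfl⟩ := h h1 h2 h3
  rfl

/-- Reversing the order of a triple sum. -/
theorem sum_sum_sum_reverse {ι : Type*} [Fintype ι] (F : ι → ι → ι → ℂ) :
    ∑ a, ∑ b, ∑ c, F a b c = ∑ c, ∑ b, ∑ a, F a b c := by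
  rw [Finset.sum_congr rfl fun a _ => Finset.sum_comm, Finset.sum_comm]
  exact Finset.sum_congr rfl fun c _ => Finset.sum_comm

/-- Cyclically rotating the order of a triple sum. -/
theorem sum_sum_sum_rotate {ι : Type*} [Fintype ι] (F : ι → ι → ι → ℂ) :
    ∑ a, ∑ b, ∑ c, F a b c = ∑ c, ∑ a, ∑ b, F a b c := by
  rw [Finset.sum_congr rfl fun a _ => Finset.sum_comm, Finset.sum_comm]

theorem Dmat_unitary {n : ℕ} (μ : ℂ) (A : SDM n) (f : ℂ → ℂ)
    (hZW : ZeroWeight A) (hU : Unitary A) : Unitary (Dmat μ f A) := by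
  intro z1 z2 q
  ext ⟨i, j⟩ ⟨k, l⟩
  have h := congrFun (congrFun (hU (f z1) (f z2) (q + μ • (ee n i + ee n j))) (k, l)) (i, j)
  rw [Matrix.mul_apply] at h ⊢
  simp only [Fintype.sum_prod_type, swapDM, Dmat, Matrix.of_apply] at h ⊢
  rw [Matrix.one_apply] at h ⊢
  simp only [eq_comm (a := (i, j)), ← h]
  refine Finset.sum_congr rfl fun a _ => Finset.sum_congr rfl fun b _ => ?_
  by_cases hw : ee n b + ee n a = ee n j + ee n i
  · rw [mul_comm, add_comm (ee n b), hw.symm.trans (add_comm _ _) |>.symm.trans (add_comm _ _)]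
  · simp [hZW _ _ _ _ _ _ _ hw]

theorem Dmat_YBD {n : ℕ} (μ : ℂ) (A : SDM n) (f : ℂ → ℂ)
    (hZW : ZeroWeight A) (hYB : YBA μ A) : YBD μ (Dmat μ f A) := by
  intro z1 z2 z3 q
  ext ⟨i, j, k⟩ ⟨l, m, r⟩
  rw [pl12_mul_pl13_mul_pl23_apply, pl23_mul_pl13_mul_pl12_apply]
  simp only [Dmat, Matrix.of_apply]
  have h := hYB.apply (f z3) (f z2) (f z1) (q + μ • (ee n i + ee n j + ee n k)) r m l k j i
  refine Eq.trans ?_ (h.trans ?_)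
  · rw [sum_sum_sum_reverse]
    refine Finset.sum_congr rfl fun c _ => Finset.sum_congr rfl fun b _ =>
      Finset.sum_congr rfl fun a _ => ?_
    rw [mul_right_comm, mul_rotate]
    exact hZW.mul_mul_congr fun h1 h2 h3 =>
      ⟨by linear_combination (norm := module) μ • (h2 + h3),
        by linear_combination (norm := module) μ • h3, by module⟩
  · rw [sum_sum_sum_reverse]
    refine Finset.sum_congr rfl fun a _ => Finset.sum_congr rfl fun b _ =>
      Finset.sum_congr rfl fun c _ => ?_
    rw [mul_right_comm, mul_rotate]
    exact hZW.mul_mul_congr fun h1 h2 h3 =>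
      ⟨by module, by linear_combination (norm := module) -μ • h1,
        by linear_combination (norm := module) -μ • (h1 + h2)⟩

theorem Cmat_YBAC {n : ℕ} (μ : ℂ) (A : SDM n) (f : ℂ → ℂ)
    (hZW : ZeroWeight A) (hYB : YBA μ A) : YBAC μ A (Cmat μ f A) := by
  intro z1 z2 z3 q
  ext ⟨i, j, k⟩ ⟨l, m, r⟩
  rw [pl12_mul_pl13_mul_pl23_apply, pl23_mul_pl13_mul_pl12_apply]
  simp only [Cmat, Matrix.of_apply]
  have h := hYB.apply (f z3) z1 z2 (q + μ • ee n r) r i j k l m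
  refine Eq.trans ?_ (h.symm.trans ?_)
  · rw [sum_sum_sum_rotate]
    refine Finset.sum_congr rfl fun c _ => Finset.sum_congr rfl fun a _ =>
      Finset.sum_congr rfl fun b _ => ?_
    rw [mul_right_comm]
    exact hZW.mul_mul_congr fun h1 h2 h3 =>
      ⟨by module, rfl, by linear_combination (norm := module) -μ • h2⟩
  · rw [← sum_sum_sum_rotate]
    refine Finset.sum_congr rfl fun a _ => Finset.sum_congr rfl fun b _ =>
      Finset.sum_congr rfl fun c _ => ?_
    rw [mul_assoc, mul_left_comm, ← mul_assoc]
    exact hZW.mul_mul_congr fun h1 h2 h3 =>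
      ⟨by linear_combination (norm := module) μ • h2, rfl, rfl⟩

theorem Dmat_Bmat_YBDB {n : ℕ} (μ : ℂ) (A : SDM n) (f : ℂ → ℂ)
    (hZW : ZeroWeight A) (hYB : YBA μ A) : YBDB μ (Dmat μ f A) (Bmat μ f A) := by
  intro z1 z2 z3 q
  ext ⟨i, j, k⟩ ⟨l, m, r⟩
  rw [pl12_mul_pl13_mul_pl23_apply, pl23_mul_pl13_mul_pl12_apply]
  simp only [Dmat, Bmat, Matrix.of_apply]
  have h := hYB.apply (f z2) (f z1) z3 (q + μ • (ee n l + ee n m)) m l k j i r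
  refine Eq.trans ?_ (h.symm.trans ?_)
  · rw [Finset.sum_comm]
    refine Finset.sum_congr rfl fun b _ => Finset.sum_congr rfl fun a _ =>
      Finset.sum_congr rfl fun c _ => ?_
    rw [mul_rotate]
    exact hZW.mul_mul_congr fun h1 h2 h3 =>
      ⟨by module, by module, by linear_combination (norm := module) -μ • (h1 + h2 + h3)⟩
  · rw [Finset.sum_comm]
    refine Finset.sum_congr rfl fun a _ => Finset.sum_congr rfl fun b _ =>
      Finset.sum_congr rfl fun c _ => ?_
    rw [mul_assoc, mul_comm]
    exact hZW.mul_mul_congr fun h1 h2 h3 =>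
      ⟨by linear_combination (norm := module) μ • h3,
        by linear_combination (norm := module) μ • h3,
        by linear_combination (norm := module) μ • h3⟩

/-- Theorem 3.3 of the paper.  From a zero-weight, unitary
solution `A` of (YB-A) and any function `f : ℂ → ℂ`, the matrices `B`, `C`, `D`
defined entrywise from `A` satisfy: (1) `B₁₂(z₁,z₂;q) = C₂₁(z₂,z₁;q)`;
(2) `D` is unitary; (3) (YB-D), (YB-AC) and (YB-DB) hold. -/
theorem statement1 {n : ℕ} (μ : ℂ) (A : SDM n) (f : ℂ → ℂ)
    (hZW : ZeroWeight A) (hU : Unitary A) (hYB : YBA μ A) :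
    (∀ z1 z2 q, Bmat μ f A z1 z2 q = swapDM (Cmat μ f A z2 z1 q)) ∧
    Unitary (Dmat μ f A) ∧
    YBD μ (Dmat μ f A) ∧
    YBAC μ A (Cmat μ f A) ∧
    YBDB μ (Dmat μ f A) (Bmat μ f A) := by
  exact ⟨fun _ _ _ => rfl, Dmat_unitary μ A f hZW hU, Dmat_YBD μ A f hZW hYB,
    Cmat_YBAC μ A f hZW hYB, Dmat_Bmat_YBDB μ A f hZW hYB⟩

end Paper

end
end

section
/- Let A(z_1,z_2;q) be a zero-weight, unitary dynamical matrix on V⊗V satisfying (YB-A), f : ℂ → ℂ, and define D entrywise by D_{(i,j),(k,l)}(z_1,z_2;q) = A_{(l,k),(j,i)}(f(z_2),f(z_1); q+μ(e_i+e_j)). Let H be a weight-graded complex vector space and T(z;q) an n×n matrix of End(H)-valued functions that is zero-weight for h^{(1)}+h^{(q)} and satisfies the bulk exchange relation A_{12}(z_1,z_2;q) T_1(z_1;q−h^{(2)}) T_2(z_2;q) = T_2(z_2;q−h^{(1)}) T_1(z_1;q) A_{12}(z_1,z_2;q−h^{(q)}) on V⊗V⊗H. Define the transposed Lax matrix 𝒯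 by 𝒯_{ij}(z;q) = T_{ji}(f(z); q+μe_j). Then 𝒯 satisfies the transposed exchange relation D_{12}(z_1,z_2;q−h^{(q)}) 𝒯_1(z_1;q) 𝒯_2(z_2;q+h^{(1)}) = 𝒯_2(z_2;q) 𝒯_1(z_1;q+h^{(2)}) D_{12}(z_1,z_2;q) on V⊗V⊗H. -/
open scoped BigOperators

noncomputable section

namespace Paper

attribute [local instance] Classical.propDecidable

open DirectSum

variable {n : ℕ}

/-- Operators on the weight-graded quantum space `H = ⨁_{λ} H_λ`. -/
abbrev EndH (n : ℕ) (Hf : (Fin n → ℂ) → Type*) [∀ l, AddCommGroup (Hf l)]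
    [∀ l, Module ℂ (Hf l)] :=
  Module.End ℂ (⨁ l, Hf l)

/-- For a family `F` of endomorphisms of `H` depending on `q`, the operator
`F(q + c·h^{(q)})`, acting on a vector of `H`-weight `λ` as `F(q + c λ)`
(take `c = ±μ` for `F(q ± h^{(q)})`, `c = αμ` for `F(q + α h^{(q)})`). -/
def qshift (Hf : (Fin n → ℂ) → Type*) [∀ l, AddCommGroup (Hf l)] [∀ l, Module ℂ (Hf l)]
    (F : (Fin n → ℂ) → EndH n Hf) (q : Fin n → ℂ) (c : ℂ) : EndH n Hf :=
  DirectSum.toModule ℂ (Fin n → ℂ) (⨁ l, Hf l)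
    (fun l => (F (q + c • l)).comp (DirectSum.lof ℂ (Fin n → ℂ) Hf l))

/-- Zero-weight condition for a quantum Lax matrix `T` under `h^{(1)} + h^{(q)}`:
`T_{ij}` maps `H_λ` into `H_{λ + e_j - e_i}`. -/
def LaxZeroWeight (Hf : (Fin n → ℂ) → Type*) [∀ l, AddCommGroup (Hf l)]
    [∀ l, Module ℂ (Hf l)]
    (T : ℂ → Qn n → Matrix (Fin n) (Fin n) (EndH n Hf)) : Prop :=
  ∀ z q (i j : Fin n) l x,
    T z q i j (DirectSum.lof ℂ (Fin n → ℂ) Hf l x) ∈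
      LinearMap.range (DirectSum.lof ℂ (Fin n → ℂ) Hf (l + ee n j - ee n i))

/-- The bulk dynamical exchange relation on `V ⊗ V ⊗ H`:
`A₁₂(z₁,z₂;q) T₁(z₁;q-h²) T₂(z₂;q) = T₂(z₂;q-h¹) T₁(z₁;q) A₁₂(z₁,z₂;q-h^{(q)})`. -/
def BulkRel (Hf : (Fin n → ℂ) → Type*) [∀ l, AddCommGroup (Hf l)]
    [∀ l, Module ℂ (Hf l)] (μ : ℂ) (A : SDM n)
    (T : ℂ → Qn n → Matrix (Fin n) (Fin n) (EndH n Hf)) : Prop :=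
  ∀ z1 z2 q,
    sc (A z1 z2 q) * op1 (fun m => T z1 (q - μ • ee n m)) *
        op2 (fun _ => T z2 q) =
      op2 (fun m => T z2 (q - μ • ee n m)) * op1 (fun _ => T z1 q) *
        Matrix.of (fun p p' =>
          qshift Hf (fun q' => (A z1 z2 q' p p') • (1 : EndH n Hf)) q (-μ))

/-- The transposed Lax matrix `𝒯_{ij}(z;q) = T_{ji}(f z; q + μ e_j)`. -/
def TLax (Hf : (Fin n → ℂ) → Type*) [∀ l, AddCommGroup (Hf l)] [∀ l, Module ℂ (Hf l)]
    (μ : ℂ) (f : ℂ → ℂ) (T : ℂ → Qn n → Matrix (Fin n) (Fin n) (EndH n Hf)) :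
    ℂ → Qn n → Matrix (Fin n) (Fin n) (EndH n Hf) :=
  fun z q => Matrix.of fun i j => T (f z) (q + μ • ee n j) j i


section GradedOperators

variable {Hf : (Fin n → ℂ) → Type*} [∀ l, AddCommGroup (Hf l)] [∀ l, Module ℂ (Hf l)]

theorem qshift_lof (F : Qn n → EndH n Hf) (q : Qn n) (c : ℂ) (l : Qn n) (x : Hf l) :
    qshift Hf F q c (lof ℂ (Fin n → ℂ) Hf l x) =
      F (q + c • l) (lof ℂ (Fin n → ℂ) Hf l x) := by
  simp [qshift, toModule_lof]

/-- A homogeneous operator of degree `δ` intertwines two shifted scalar functions that agree after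
the corresponding shift of their arguments. -/
theorem qshift_smul_one_mul_of_homogeneous {X : EndH n Hf} {δ : Qn n}
    (hX : ∀ l x, X (lof ℂ (Fin n → ℂ) Hf l x) ∈
      LinearMap.range (lof ℂ (Fin n → ℂ) Hf (l + δ)))
    {g g' : Qn n → ℂ} {q q' : Qn n} {c : ℂ}
    (hg : ∀ l, g (q + c • (l + δ)) = g' (q' + c • l)) :
    qshift Hf (fun r => g r • (1 : EndH n Hf)) q c * X =
      X * qshift Hf (fun r => g' r • (1 : EndH n Hf)) q' c := by
  refine DirectSum.linearMap_ext ℂ fun l => LinearMap.ext fun x => ?_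
  obtain ⟨y, hy⟩ := hX l x
  simp only [LinearMap.comp_apply, Module.End.mul_apply, qshift_lof, LinearMap.smul_apply,
    Module.End.one_apply, map_smul]
  rw [← hy, qshift_lof, LinearMap.smul_apply, Module.End.one_apply, hg]

theorem LaxZeroWeight.mul_mem_range {T : ℂ → Qn n → Matrix (Fin n) (Fin n) (EndH n Hf)}
    (hT : LaxZeroWeight Hf T) (w w' : ℂ) (q q' : Qn n) (i j k m : Fin n) (l : Qn n) (x : Hf l) :
    (T w q i j * T w' q' k m) (lof ℂ (Fin n → ℂ) Hf l x) ∈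
      LinearMap.range
        (lof ℂ (Fin n → ℂ) Hf (l + (ee n m - ee n k + (ee n j - ee n i)))) := by
  obtain ⟨y, hy⟩ := hT w' q' k m l x
  have h := hT w q i j _ y
  rw [hy] at h
  rwa [show l + (ee n m - ee n k + (ee n j - ee n i)) =
    l + ee n m - ee n k + ee n j - ee n i by abel]

end GradedOperators

section Entries

variable {R : Type*} [Semiring R]

theorem mul_op1_apply (M : Matrix (Fin n × Fin n) (Fin n × Fin n) R)
    (X : Fin n → Matrix (Fin n) (Fin n) R) (p : Fin n × Fin n) (c d : Fin n) :
    (M * op1 X) p (c, d) = ∑ i, M p (i, d) * X d i c := by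
  simp [Matrix.mul_apply, op1, Fintype.sum_prod_type]

theorem mul_op2_apply (M : Matrix (Fin n × Fin n) (Fin n × Fin n) R)
    (X : Fin n → Matrix (Fin n) (Fin n) R) (p : Fin n × Fin n) (c d : Fin n) :
    (M * op2 X) p (c, d) = ∑ j, M p (c, j) * X c j d := by
  simp [Matrix.mul_apply, op2, Fintype.sum_prod_type]

theorem mul_op1_mul_op2_apply (M : Matrix (Fin n × Fin n) (Fin n × Fin n) R)
    (X Y : Fin n → Matrix (Fin n) (Fin n) R) (p : Fin n × Fin n) (c d : Fin n) :
    (M * op1 X * op2 Y) p (c, d) = ∑ j, ∑ i, M p (i, j) * X j i c * Y c j d := by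
  simp [mul_op2_apply, mul_op1_apply, Finset.sum_mul]

theorem op2_mul_op1_mul_apply (M : Matrix (Fin n × Fin n) (Fin n × Fin n) R)
    (X Y : Fin n → Matrix (Fin n) (Fin n) R) (a b : Fin n) (p : Fin n × Fin n) :
    (op2 Y * op1 X * M) (a, b) p = ∑ j, ∑ i, Y a b j * X j a i * M (i, j) p := by
  rw [Matrix.mul_apply, Fintype.sum_prod_type, Finset.sum_comm]
  simp [mul_op1_apply, op2]

end Entries

/-- Entrywise form of the bulk exchange relation. -/
theorem BulkRel.entry {Hf : (Fin n → ℂ) → Type*} [∀ l, AddCommGroup (Hf l)]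
    [∀ l, Module ℂ (Hf l)] {μ : ℂ} {A : SDM n}
    {T : ℂ → Qn n → Matrix (Fin n) (Fin n) (EndH n Hf)} (hbulk : BulkRel Hf μ A T)
    (w1 w2 : ℂ) (p : Qn n) (a b c d : Fin n) :
    ∑ j, ∑ i, algebraMap ℂ (EndH n Hf) (A w1 w2 p (a, b) (i, j)) *
        T w1 (p - μ • ee n j) i c * T w2 p j d =
      ∑ j, ∑ i, T w2 (p - μ • ee n a) b j * T w1 p a i *
        qshift Hf (fun r => A w1 w2 r (i, j) (c, d) • (1 : EndH n Hf)) p (-μ) := by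
  have h := congrFun (congrFun (hbulk w1 w2 p) (a, b)) (c, d)
  rwa [mul_op1_mul_op2_apply, op2_mul_op1_mul_apply] at h

/-- transposed exchange relation, Theorem 3.4.  If `T` is a
zero-weight quantum Lax matrix for `A` on `V ⊗ V ⊗ H`, then the transposed Lax
matrix `𝒯_{ij}(z;q) = T_{ji}(f z; q+μ e_j)` satisfies
`D₁₂(z₁,z₂;q-h^{(q)}) 𝒯₁(z₁;q) 𝒯₂(z₂;q+h¹) = 𝒯₂(z₂;q) 𝒯₁(z₁;q+h²) D₁₂(z₁,z₂;q)`. -/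
theorem statement2 {n : ℕ} (μ : ℂ) (A : SDM n) (f : ℂ → ℂ)
    (Hf : (Fin n → ℂ) → Type*) [∀ l, AddCommGroup (Hf l)] [∀ l, Module ℂ (Hf l)]
    (T : ℂ → Qn n → Matrix (Fin n) (Fin n) (EndH n Hf))
    (hZW : ZeroWeight A) (hU : Unitary A) (hYB : YBA μ A)
    (hT : LaxZeroWeight Hf T) (hbulk : BulkRel Hf μ A T) :
    ∀ z1 z2 q,
      Matrix.of (fun p p' =>
          qshift Hf (fun q' => (Dmat μ f A z1 z2 q' p p') • (1 : EndH n Hf)) q (-μ)) *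
          op1 (fun _ => TLax Hf μ f T z1 q) *
          op2 (fun m => TLax Hf μ f T z2 (q + μ • ee n m)) =
        op2 (fun _ => TLax Hf μ f T z2 q) *
          op1 (fun m => TLax Hf μ f T z1 (q + μ • ee n m)) *
          sc (Dmat μ f A z1 z2 q) := by
  intro z1 z2 q
  ext1 ⟨a, b⟩ ⟨c, d⟩
  rw [mul_op1_mul_op2_apply, op2_mul_op1_mul_apply]
  simp only [TLax, Matrix.of_apply, sc, Matrix.map_apply]
  set p : Qn n := q + μ • (ee n c + ee n d) with hp
  have hL : ∀ j i,
      qshift Hf (fun r => Dmat μ f A z1 z2 r (a, b) (i, j) • (1 : EndH n Hf)) q (-μ) *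
          T (f z1) (q + μ • ee n c) c i * T (f z2) (q + μ • ee n c + μ • ee n d) d j =
        T (f z1) (p - μ • ee n d) c i * T (f z2) p d j *
          qshift Hf (fun r => A (f z2) (f z1) r (j, i) (b, a) • (1 : EndH n Hf)) p (-μ) := by
    intro j i
    rw [show q + μ • ee n c = p - μ • ee n d by rw [hp]; module,
      show p - μ • ee n d + μ • ee n d = p by abel, mul_assoc]
    refine qshift_smul_one_mul_of_homogeneous (hT.mul_mem_range _ _ _ _ _ _ _ _) fun l => ?_
    simp only [Dmat, Matrix.of_apply]
    by_cases h : ee n j + ee n i = ee n b + ee n a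
    · congr 1
      rw [add_comm (ee n a), ← h, hp]
      module
    · rw [hZW _ _ _ _ _ _ _ h, hZW _ _ _ _ _ _ _ h]
  have hR : ∀ j i,
      T (f z2) (q + μ • ee n j) j b * T (f z1) (q + μ • ee n j + μ • ee n i) i a *
          algebraMap ℂ (EndH n Hf) (Dmat μ f A z1 z2 q (i, j) (c, d)) =
        algebraMap ℂ (EndH n Hf) (A (f z2) (f z1) p (d, c) (j, i)) *
          T (f z2) (p - μ • ee n i) j b * T (f z1) p i a := by
    intro j i
    simp only [Dmat, Matrix.of_apply]
    by_cases h : ee n d + ee n c = ee n j + ee n i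
    · have hpij : p = q + μ • (ee n j + ee n i) := by rw [hp, add_comm (ee n c), h]
      rw [add_comm (ee n i), ← hpij, show q + μ • ee n j + μ • ee n i = p by rw [hpij]; module,
        show q + μ • ee n j = p - μ • ee n i by rw [hpij]; module, mul_assoc (algebraMap _ _ _),
        Algebra.commutes]
    · simp [hZW _ _ _ _ _ _ _ h]
  simp only [hL, hR]
  rw [Finset.sum_comm, ← hbulk.entry, Finset.sum_comm]

end Paper

end
end

section
/- Let A, B, C, D be dynamical matrices on V⊗V (with spectral parameters) satisfying (YB-A), (YB-D), (YB-AC), (YB-DB), with A and D zero-weight and unitary, entries of B and C vanishing unless e_i−e_j = e_k−e_l, and C_{12}(z_1,z_2;q) = B_{21}(z_2,z_1;q). Take as quantum space H = V with grading H_{e_m} = ℂe_m, and define L and J as n×n matrices of End(V)-valued functions by L_{ij}(z;q) = the End(V)-entry of C_{1a}(z,0;q) in auxiliary indices (i,j) (i.e. (L_{ij})_{m'm} = C_{(i,m'),(j,m)}(z,0;q)) and J_{ij}(z;q) likewise from D_{1a}(z,0;q). Then L and J satisfy the coaction relations (a)–(e) with α = 1. -/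
open scoped BigOperators

noncomputable section

namespace Paper

/-- Exchange of the second and third tensor factors of `V ⊗ V ⊗ V`. -/
def swapSites23 (n : ℕ) : I3 n ≃ I3 n where
  toFun p := (p.1, p.2.2, p.2.1)
  invFun p := (p.1, p.2.2, p.2.1)
  left_inv _ := rfl
  right_inv _ := rfl

/-- Cyclic rotation of the tensor factors of `V ⊗ V ⊗ V`. -/
def rotateSites (n : ℕ) : I3 n ≃ I3 n where
  toFun p := (p.2.1, p.2.2, p.1)
  invFun p := (p.2.2, p.1, p.2.1)
  left_inv _ := rfl
  right_inv _ := rfl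

section Placement

variable {n : ℕ} {R : Type*} [Zero R] (X : Fin n → Matrix (Fin n × Fin n) (Fin n × Fin n) R)

theorem pl12_submatrix_swapSites23 :
    (pl12 X).submatrix (swapSites23 n) (swapSites23 n) = pl13 X := rfl

theorem pl13_submatrix_swapSites23 :
    (pl13 X).submatrix (swapSites23 n) (swapSites23 n) = pl12 X := rfl

theorem pl23_submatrix_swapSites23 :
    (pl23 X).submatrix (swapSites23 n) (swapSites23 n) = pl23 fun m => swapDM (X m) := rfl

theorem pl12_submatrix_rotateSites :
    (pl12 X).submatrix (rotateSites n) (rotateSites n) = pl23 X := rfl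

theorem pl13_submatrix_rotateSites :
    (pl13 X).submatrix (rotateSites n) (rotateSites n) = pl12 fun m => swapDM (X m) := rfl

theorem pl23_submatrix_rotateSites :
    (pl23 X).submatrix (rotateSites n) (rotateSites n) = pl13 fun m => swapDM (X m) := rfl

end Placement

/-- Reindexing both sides of an equation between triple products of matrices. -/
theorem submatrix_mul_mul_eq {ι R : Type*} [Fintype ι] [NonUnitalNonAssocSemiring R]
    (σ : ι ≃ ι) {M₁ M₂ M₃ N₁ N₂ N₃ : Matrix ι ι R} (h : M₁ * M₂ * M₃ = N₁ * N₂ * N₃) :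
    M₁.submatrix σ σ * M₂.submatrix σ σ * M₃.submatrix σ σ =
      N₁.submatrix σ σ * N₂.submatrix σ σ * N₃.submatrix σ σ := by
  simp only [Matrix.submatrix_mul_equiv, h]

/-- Example 1 (`α = 1`): with quantum space `H = V` graded by `H_{e_m} = ℂ e_m`, taking `L₁(z) = C_{1a}(z,0)` and `J₁(z) = D_{1a}(z,0)` realizes the coaction relations (a)–(e) with `α = 1`. -/
theorem statement6 {n : ℕ} (μ : ℂ) (A B C D : SDM n)
    (hYBA : YBA μ A) (hYBD : YBD μ D) (hYBAC : YBAC μ A C) (hYBDB : YBDB μ D B)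
    (hZWA : ZeroWeight A) (hZWD : ZeroWeight D)
    (hUA : Unitary A) (hUD : Unitary D)
    (hWB : BCWeight B) (hWC : BCWeight C) (hCB : CisB21 B C)
    (α : ℂ) (hα : α = 1)
    -- `L` and `J`, as `End(V)`-valued `n×n` matrices, flattened on `V ⊗ V`:
    -- `(L_{ij})_{m'm}(z;q) = L (z;q) (i,m') (j,m)` and likewise for `J`.
    (L J : ℂ → Qn n → DM n)
    (hL : ∀ z q, L z q = C z 0 q) (hJ : ∀ z q, J z q = D z 0 q) :
    -- (a)
    (∀ z1 z2 q,
      pl12 (fun _ => A z1 z2 q) * pl13 (fun m => L z1 (q - μ • ee n m)) *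
          pl23 (fun _ => L z2 q) =
        pl23 (fun m => L z2 (q - μ • ee n m)) * pl13 (fun _ => L z1 q) *
          pl12 (fun m => A z1 z2 (q + (α * μ) • ee n m))) ∧
    -- (b)
    (∀ z1 z2 q,
      pl12 (fun m => D z1 z2 (q + (α * μ) • ee n m)) * pl13 (fun _ => J z1 q) *
          pl23 (fun m => J z2 (q + μ • ee n m)) =
        pl23 (fun _ => J z2 q) * pl13 (fun m => J z1 (q + μ • ee n m)) *
          pl12 (fun _ => D z1 z2 q)) ∧
    -- (c)
    (∀ z1 z2 q,
      pl13 (fun m => J z1 (q - μ • ee n m)) * pl12 (fun _ => B z1 z2 q) *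
          pl23 (fun m => L z2 (q + μ • ee n m)) =
        pl23 (fun _ => L z2 q) * pl12 (fun m => B z1 z2 (q + (α * μ) • ee n m)) *
          pl13 (fun _ => J z1 q)) ∧
    -- (d)
    (∀ z1 z2 q,
      pl23 (fun m => J z2 (q - μ • ee n m)) * pl12 (fun _ => C z1 z2 q) *
          pl13 (fun m => L z1 (q + μ • ee n m)) =
        pl13 (fun _ => L z1 q) * pl12 (fun m => C z1 z2 (q + (α * μ) • ee n m)) *
          pl23 (fun _ => J z2 q)) ∧
    -- (e)
    (∀ z q (i m' j m : Fin n),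
      ee n m' ≠ ee n m + α⁻¹ • (ee n i - ee n j) → L z q (i, m') (j, m) = 0) ∧
    (∀ z q (i m' j m : Fin n),
      ee n m' ≠ ee n m - α⁻¹ • (ee n i - ee n j) → J z q (i, m') (j, m) = 0) := by
  subst hα
  obtain rfl : L = fun z q => C z 0 q := funext fun z => funext fun q => hL z q
  obtain rfl : J = fun z q => D z 0 q := funext fun z => funext fun q => hJ z q
  simp only [one_mul, inv_one, one_smul]
  refine ⟨fun z1 z2 q => hYBAC z1 z2 0 q, fun z1 z2 q => hYBD z1 z2 0 q, ?_, ?_, ?_, ?_⟩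
  · intro z1 z2 q
    have h := submatrix_mul_mul_eq (swapSites23 n) (hYBDB z1 0 z2 q)
    simpa only [pl12_submatrix_swapSites23, pl13_submatrix_swapSites23,
      pl23_submatrix_swapSites23, ← hCB _ _ _] using h
  · intro z1 z2 q
    have h := submatrix_mul_mul_eq (rotateSites n) (hYBDB z2 0 z1 q)
    simpa only [pl12_submatrix_rotateSites, pl13_submatrix_rotateSites,
      pl23_submatrix_rotateSites, ← hCB _ _ _] using h
  · intro z q i m' j m hne
    refine hWC z 0 q i m' j m fun h => hne ?_
    linear_combination -h
  · intro z q i m' j m hne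
    refine hZWD z 0 q i m' j m fun h => hne ?_
    linear_combination h

end Paper

end
end

section
/- Let A, B, C, D be dynamical matrices on V⊗V (with spectral parameters) satisfying (YB-A), (YB-D), (YB-AC), (YB-DB), with A and D zero-weight and unitary, entries of B and C vanishing unless e_i−e_j = e_k−e_l, and C_{12}(z_1,z_2;q) = B_{21}(z_2,z_1;q). Take as quantum space H = V with grading H_{e_m} = ℂe_m, and define L and J as n×n matrices of End(V)-valued functions by (L_{ij})_{m'm}(z;q) = A_{(i,m'),(j,m)}(z,0;q) and (J_{ij})_{m'm}(z;q) = B_{(i,m'),(j,m)}(z,0;q). Then L and J satisfy the coaction relations (a)–(e) with α = −1. -/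
open scoped BigOperators

noncomputable section

namespace Paper

/-- The cyclic relabelling of the three tensor factors. -/
def cycleSites (n : ℕ) : I3 n ≃ I3 n where
  toFun p := (p.2.1, p.2.2, p.1)
  invFun p := (p.2.2, p.1, p.2.1)
  left_inv _ := rfl
  right_inv _ := rfl

/-- The exchange of the last two tensor factors. -/
def swapSites (n : ℕ) : I3 n ≃ I3 n where
  toFun p := (p.1, p.2.2, p.2.1)
  invFun p := (p.1, p.2.2, p.2.1)
  left_inv _ := rfl
  right_inv _ := rfl

section Relabel

variable {n : ℕ} {R : Type*} [Zero R] (X : Fin n → Matrix (Fin n × Fin n) (Fin n × Fin n) R)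

lemma pl12_submatrix_cycleSites :
    (pl12 X).submatrix (cycleSites n) (cycleSites n) = pl23 X := rfl

lemma pl13_submatrix_cycleSites :
    (pl13 X).submatrix (cycleSites n) (cycleSites n) = pl12 fun m => swapDM (X m) := rfl

lemma pl23_submatrix_cycleSites :
    (pl23 X).submatrix (cycleSites n) (cycleSites n) = pl13 fun m => swapDM (X m) := rfl

lemma pl12_submatrix_swapSites :
    (pl12 X).submatrix (swapSites n) (swapSites n) = pl13 X := rfl

lemma pl13_submatrix_swapSites :
    (pl13 X).submatrix (swapSites n) (swapSites n) = pl12 X := rfl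

lemma pl23_submatrix_swapSites :
    (pl23 X).submatrix (swapSites n) (swapSites n) = pl23 fun m => swapDM (X m) := rfl

end Relabel

lemma swapDM_swapDM {n : ℕ} {R : Type*} (M : Matrix (Fin n × Fin n) (Fin n × Fin n) R) :
    swapDM (swapDM M) = M := rfl

/-- (YB-AC) read on the sites `2, 3, 1`, in terms of `B`. -/
lemma YBAC.cycle {n : ℕ} {μ : ℂ} {A B C : SDM n} (h : YBAC μ A C) (hCB : CisB21 B C)
    (z1 z2 z3 : ℂ) (q : Qn n) :
    pl13 (fun m => B z1 z3 (q - μ • ee n m)) * pl12 (fun _ => B z1 z2 q) *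
        pl23 (fun m => A z2 z3 (q + μ • ee n m)) =
      pl23 (fun _ => A z2 z3 q) * pl12 (fun m => B z1 z2 (q - μ • ee n m)) *
        pl13 (fun _ => B z1 z3 q) := by
  have := congrArg (fun M : M3 n ℂ => M.submatrix (cycleSites n) (cycleSites n)) (h z2 z3 z1 q)
  simp only [← Matrix.submatrix_mul_equiv _ _ _ (cycleSites n), pl12_submatrix_cycleSites,
    pl13_submatrix_cycleSites, pl23_submatrix_cycleSites, hCB _ _ _, swapDM_swapDM] at this
  exact this.symm

/-- (YB-AC) read on the sites `1, 3, 2`, in terms of `B` and `C`. -/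
lemma YBAC.swap {n : ℕ} {μ : ℂ} {A B C : SDM n} (h : YBAC μ A C) (hCB : CisB21 B C)
    (z1 z2 z3 : ℂ) (q : Qn n) :
    pl23 (fun m => B z2 z3 (q - μ • ee n m)) * pl12 (fun _ => C z1 z2 q) *
        pl13 (fun m => A z1 z3 (q + μ • ee n m)) =
      pl13 (fun _ => A z1 z3 q) * pl12 (fun m => C z1 z2 (q - μ • ee n m)) *
        pl23 (fun _ => B z2 z3 q) := by
  have := congrArg (fun M : M3 n ℂ => M.submatrix (swapSites n) (swapSites n)) (h z1 z3 z2 q)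
  simp only [← Matrix.submatrix_mul_equiv _ _ _ (swapSites n), pl12_submatrix_swapSites,
    pl13_submatrix_swapSites, pl23_submatrix_swapSites, hCB z3 z2, swapDM_swapDM] at this
  exact this.symm

/-- Example 2 (`α = -1`): with quantum space `H = V` graded by `H_{e_m} = ℂ e_m`, taking `(L_{ij})_{m'm}(z;q) = A_{(i,m'),(j,m)}(z,0;q)` and `(J_{ij})_{m'm}(z;q) = B_{(i,m'),(j,m)}(z,0;q)` realizes the coaction relations (a)–(e) with `α = -1`. -/
theorem statement7 {n : ℕ} (μ : ℂ) (A B C D : SDM n)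
    (hYBA : YBA μ A) (hYBD : YBD μ D) (hYBAC : YBAC μ A C) (hYBDB : YBDB μ D B)
    (hZWA : ZeroWeight A) (hZWD : ZeroWeight D)
    (hUA : Unitary A) (hUD : Unitary D)
    (hWB : BCWeight B) (hWC : BCWeight C) (hCB : CisB21 B C)
    (α : ℂ) (hα : α = -1)
    -- `L` and `J`, as `End(V)`-valued `n×n` matrices, flattened on `V ⊗ V`:
    -- `(L_{ij})_{m'm}(z;q) = L (z;q) (i,m') (j,m)` and likewise for `J`.
    (L J : ℂ → Qn n → DM n)
    (hL : ∀ z q, L z q = A z 0 q) (hJ : ∀ z q, J z q = B z 0 q) :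
    -- (a)
    (∀ z1 z2 q,
      pl12 (fun _ => A z1 z2 q) * pl13 (fun m => L z1 (q - μ • ee n m)) *
          pl23 (fun _ => L z2 q) =
        pl23 (fun m => L z2 (q - μ • ee n m)) * pl13 (fun _ => L z1 q) *
          pl12 (fun m => A z1 z2 (q + (α * μ) • ee n m))) ∧
    -- (b)
    (∀ z1 z2 q,
      pl12 (fun m => D z1 z2 (q + (α * μ) • ee n m)) * pl13 (fun _ => J z1 q) *
          pl23 (fun m => J z2 (q + μ • ee n m)) =
        pl23 (fun _ => J z2 q) * pl13 (fun m => J z1 (q + μ • ee n m)) *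
          pl12 (fun _ => D z1 z2 q)) ∧
    -- (c)
    (∀ z1 z2 q,
      pl13 (fun m => J z1 (q - μ • ee n m)) * pl12 (fun _ => B z1 z2 q) *
          pl23 (fun m => L z2 (q + μ • ee n m)) =
        pl23 (fun _ => L z2 q) * pl12 (fun m => B z1 z2 (q + (α * μ) • ee n m)) *
          pl13 (fun _ => J z1 q)) ∧
    -- (d)
    (∀ z1 z2 q,
      pl23 (fun m => J z2 (q - μ • ee n m)) * pl12 (fun _ => C z1 z2 q) *
          pl13 (fun m => L z1 (q + μ • ee n m)) =
        pl13 (fun _ => L z1 q) * pl12 (fun m => C z1 z2 (q + (α * μ) • ee n m)) *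
          pl23 (fun _ => J z2 q)) ∧
    -- (e)
    (∀ z q (i m' j m : Fin n),
      ee n m' ≠ ee n m + α⁻¹ • (ee n i - ee n j) → L z q (i, m') (j, m) = 0) ∧
    (∀ z q (i m' j m : Fin n),
      ee n m' ≠ ee n m - α⁻¹ • (ee n i - ee n j) → J z q (i, m') (j, m) = 0) := by
  subst hα
  obtain rfl : L = fun z q => A z 0 q := funext₂ hL
  obtain rfl : J = fun z q => B z 0 q := funext₂ hJ
  have shift (q : Qn n) (m : Fin n) : q + (-1 * μ) • ee n m = q - μ • ee n m := by
    rw [neg_one_mul, neg_smul, sub_eq_add_neg]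
  simp only [shift]
  refine ⟨fun z1 z2 q => hYBA z1 z2 0 q, fun z1 z2 q => hYBDB z1 z2 0 q,
    fun z1 z2 q => hYBAC.cycle hCB z1 z2 0 q, fun z1 z2 q => hYBAC.swap hCB z1 z2 0 q,
    fun z q i m' j m h => hZWA _ _ _ _ _ _ _ fun e => h ?_,
    fun z q i m' j m h => hWB _ _ _ _ _ _ _ fun e => h ?_⟩
  · rw [inv_neg_one, neg_one_smul]
    linear_combination (exp := 1) e
  · rw [inv_neg_one, neg_one_smul]
    linear_combination (exp := 1) -e

end Paper

end
end

section
/- Let W = V^{⊗p} and W' = V^{⊗p'} and let A_{NM}, B_{NM}, C_{NM}, D_{NM} be End(W⊗W')-valued functions of q. Let 𝒜 be an associative unital ℂ-algebra and let K_N (a matrix in End(W) with 𝒜-valued entries depending on q) and K_M (similarly in End(W')) satisfy the exchange relation A_{NM}(q) K_N(q−h^{(M)}) B_{NM}(q) K_M(q+h^{(N)}) = K_M(q−h^{(N)}) C_{NM}(q) K_N(q+h^{(M)}) D_{NM}(q). Let Q_N, S_N be ℂ-valued End(W)-valued functions of q such that: (i) A_{NM}(q) Q_N(q−h^{(M)})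 = Q_N(q) A_{NM}(q); (ii) C_{NM}(q) Q_N(q+h^{(M)}) = Q_N(q) C_{NM}(q); (iii) D_{NM}(q) S_N(q) = S_N(q+h^{(M)}) D_{NM}(q); (iv) B_{NM}(q) S_N(q) = S_N(q−h^{(M)}) B_{NM}(q); (v) Q_N and S_N preserve total weight on W (their matrix elements between basis tensors of different total weight vanish). Then the dressed matrix K̃_N(q) := Q_N(q) K_N(q) S_N(q) satisfies the same exchange relation with K_M: A_{NM}(q) K̃_N(q−h^{(M)}) B_{NM}(q) K_M(q+h^{(N)}) = K_M(q−h^{(N)}) C_{NM}(q) K̃_N(q+h^{(M)}) D_{NM}(q). -/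
open scoped BigOperators

noncomputable section

namespace Paper

section Dressing15

variable {n : ℕ} {𝒜 : Type*} [Ring 𝒜] [Algebra ℂ 𝒜]
variable {p p' : ℕ}

/-- Basis configurations of `W = V^{⊗p}`. -/
abbrev Cfg (p n : ℕ) := Fin p → Fin n

/-- Total weight of a basis tensor of `V^{⊗p}`. -/
def twt (n p : ℕ) (v : Cfg p n) : Qn n := ∑ j, ee n (v j)

/-- Embedding into `W ⊗ W'` of a matrix acting on the `N`-group `W`, with an
argument depending on the spectator `M`-group configuration. -/
def embN (X : Cfg p' n → Matrix (Cfg p n) (Cfg p n) 𝒜) :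
    Matrix (Cfg p n × Cfg p' n) (Cfg p n × Cfg p' n) 𝒜 :=
  Matrix.of fun v w => if v.2 = w.2 then X v.2 v.1 w.1 else 0

/-- Embedding into `W ⊗ W'` of a matrix acting on the `M`-group `W'`. -/
def embM (X : Cfg p n → Matrix (Cfg p' n) (Cfg p' n) 𝒜) :
    Matrix (Cfg p n × Cfg p' n) (Cfg p n × Cfg p' n) 𝒜 :=
  Matrix.of fun v w => if v.1 = w.1 then X v.1 v.2 w.2 else 0

/-- Scalar matrices on `W ⊗ W'` viewed with entries in `𝒜`. -/
def scNM (M : Matrix (Cfg p n × Cfg p' n) (Cfg p n × Cfg p' n) ℂ) :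
    Matrix (Cfg p n × Cfg p' n) (Cfg p n × Cfg p' n) 𝒜 :=
  M.map (algebraMap ℂ 𝒜)

/-- The exchange relation
`A_{NM}(q) K_N(q-h^{(M)}) B_{NM}(q) K_M(q+h^{(N)})
 = K_M(q-h^{(N)}) C_{NM}(q) K_N(q+h^{(M)}) D_{NM}(q)` on `W ⊗ W'`. -/
def REfused (μ : ℂ)
    (Anm Bnm Cnm Dnm : Qn n → Matrix (Cfg p n × Cfg p' n) (Cfg p n × Cfg p' n) ℂ)
    (KN : Qn n → Matrix (Cfg p n) (Cfg p n) 𝒜)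
    (KM : Qn n → Matrix (Cfg p' n) (Cfg p' n) 𝒜) : Prop :=
  ∀ q,
    scNM (Anm q) * embN (fun b => KN (q - μ • twt n p' b)) * scNM (Bnm q) *
        embM (fun a => KM (q + μ • twt n p a)) =
      embM (fun a => KM (q - μ • twt n p a)) * scNM (Cnm q) *
        embN (fun b => KN (q + μ • twt n p' b)) * scNM (Dnm q)

theorem dressing_exchange {G : Type*} [Semigroup G]
    {A B C D K₁ K₂ M₁ M₂ Q Q₁ Q₂ S S₁ S₂ : G}
    (hA : A * Q₁ = Q * A) (hB : B * S = S₁ * B) (hC : C * Q₂ = Q * C) (hD : D * S = S₂ * D)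
    (hS : S * M₁ = M₁ * S) (hQ : Q * M₂ = M₂ * Q)
    (hK : A * K₁ * B * M₁ = M₂ * C * K₂ * D) :
    A * (Q₁ * K₁ * S₁) * B * M₁ = M₂ * C * (Q₂ * K₂ * S₂) * D :=
  calc
    A * (Q₁ * K₁ * S₁) * B * M₁ = (A * Q₁) * K₁ * (S₁ * B) * M₁ := by simp only [mul_assoc]
    _ = Q * A * K₁ * B * (S * M₁) := by rw [hA, ← hB]; simp only [mul_assoc]
    _ = Q * (A * K₁ * B * M₁) * S := by rw [hS]; simp only [mul_assoc]
    _ = (Q * M₂) * C * K₂ * (D * S) := by rw [hK]; simp only [mul_assoc]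
    _ = M₂ * (Q * C) * K₂ * (S₂ * D) := by rw [hQ, hD]; simp only [mul_assoc]
    _ = M₂ * C * (Q₂ * K₂ * S₂) * D := by rw [← hC]; simp only [mul_assoc]

theorem embN_mul {R : Type*} [Ring R] (X Y : Cfg p' n → Matrix (Cfg p n) (Cfg p n) R) :
    embN (fun b => X b * Y b) = embN X * embN Y := by
  ext ⟨v, b⟩ ⟨w, c⟩
  by_cases h : b = c <;>
    simp [embN, Matrix.mul_apply, Fintype.sum_prod_type, h]

theorem scNM_mul (X Y : Matrix (Cfg p n × Cfg p' n) (Cfg p n × Cfg p' n) ℂ) :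
    scNM (𝒜 := 𝒜) (X * Y) = scNM X * scNM Y :=
  Matrix.map_mul

theorem scNM_embN (X : Cfg p' n → Matrix (Cfg p n) (Cfg p n) ℂ) :
    scNM (𝒜 := 𝒜) (embN X) = embN (fun b => (X b).map (algebraMap ℂ 𝒜)) := by
  ext v w
  by_cases h : v.2 = w.2 <;> simp [scNM, embN, h]

/-- A weight-preserving scalar matrix on the `N`-group commutes with a matrix on the `M`-group
that depends on the `N`-group only through its total weight. -/
theorem embN_mul_embM_comm (X : Matrix (Cfg p n) (Cfg p n) ℂ)
    (hX : ∀ v w, twt n p v ≠ twt n p w → X v w = 0)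
    (Y : Qn n → Matrix (Cfg p' n) (Cfg p' n) 𝒜) :
    embN (fun _ => X.map (algebraMap ℂ 𝒜)) * embM (fun a => Y (twt n p a)) =
      embM (fun a => Y (twt n p a)) * embN (fun _ => X.map (algebraMap ℂ 𝒜)) := by
  ext ⟨v, b⟩ ⟨w, c⟩
  by_cases h : twt n p v = twt n p w
  · simp [embN, embM, Matrix.mul_apply, Fintype.sum_prod_type, h, Algebra.commutes]
  · simp [embN, embM, Matrix.mul_apply, Fintype.sum_prod_type, hX v w h]

/-- Lemma 6.1: dressing.  If `K_N`, `K_M` satisfy the exchange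
relation and the `ℂ`-valued matrices `Q_N`, `S_N` satisfy the intertwining
relations (i)–(iv) and preserve total weight (v), then the dressed matrix
`K̃_N(q) = Q_N(q) K_N(q) S_N(q)` satisfies the same exchange relation with
`K_M`. -/
theorem statement15 (μ : ℂ)
    (Anm Bnm Cnm Dnm : Qn n → Matrix (Cfg p n × Cfg p' n) (Cfg p n × Cfg p' n) ℂ)
    (KN : Qn n → Matrix (Cfg p n) (Cfg p n) 𝒜)
    (KM : Qn n → Matrix (Cfg p' n) (Cfg p' n) 𝒜)
    (hK : REfused μ Anm Bnm Cnm Dnm KN KM)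
    (QN SN : Qn n → Matrix (Cfg p n) (Cfg p n) ℂ)
    -- (i)
    (hQA : ∀ q, Anm q * (embN (p' := p') fun b => QN (q - μ • twt n p' b)) =
      (embN fun _ => QN q) * Anm q)
    -- (ii)
    (hQC : ∀ q, Cnm q * (embN (p' := p') fun b => QN (q + μ • twt n p' b)) =
      (embN fun _ => QN q) * Cnm q)
    -- (iii)
    (hSD : ∀ q, Dnm q * (embN (p' := p') fun _ => SN q) =
      (embN fun b => SN (q + μ • twt n p' b)) * Dnm q)
    -- (iv)
    (hSB : ∀ q, Bnm q * (embN (p' := p') fun _ => SN q) =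
      (embN fun b => SN (q - μ • twt n p' b)) * Bnm q)
    -- (v)
    (hQw : ∀ q v w, twt n p v ≠ twt n p w → QN q v w = 0)
    (hSw : ∀ q v w, twt n p v ≠ twt n p w → SN q v w = 0) :
    REfused μ Anm Bnm Cnm Dnm
      (fun q => (QN q).map (algebraMap ℂ 𝒜) * KN q * (SN q).map (algebraMap ℂ 𝒜))
      KM := by
  intro q
  have hA := congrArg (scNM (𝒜 := 𝒜)) (hQA q)
  have hC := congrArg (scNM (𝒜 := 𝒜)) (hQC q)
  have hD := congrArg (scNM (𝒜 := 𝒜)) (hSD q)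
  have hB := congrArg (scNM (𝒜 := 𝒜)) (hSB q)
  simp only [scNM_mul, scNM_embN] at hA hB hC hD
  simp only [embN_mul]
  exact dressing_exchange hA hB hC hD
    (embN_mul_embM_comm (SN q) (hSw q) fun x => KM (q + μ • x))
    (embN_mul_embM_comm (QN q) (hQw q) fun x => KM (q - μ • x)) (hK q)

end Dressing15

end Paper

end
end

section
/- Let μ ∈ ℂ with μ ≠ 0, let m_1, m_2 be positive reals, and let k be a nonnegative integer. Define ψ(q) = [Γ((q+μ)/(4μ) + 1/2)/Γ((q+μ)/(4μ))] · exp(−(q/(2μ)) · ln(m_1/m_2)) · sin(kπq/μ) and φ(q) = [Γ((q+μ)/(4μ) + 1/2)/Γ((q+μ)/(4μ))] · exp(−(q/(2μ)) · ln(m_1/m_2)) · cos(kπq/μ), where Γ is the complex Gamma function and sin, cos, exp are the complex functions. Then for every q ∈ ℂ such that none of (q+μ)/(4μ), (q+μ)/(4μ) + 1/2, (q+μ)/(4μ) − 1/2 is a nonpositive integer, one has (m_1²/(q+μ)) · ψ(q+2μ) = (m_2²/(q−μ)) · ψ(q−2μ), and the same identity with φ in place of ψ. In other words, ψ and φ are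 eigenfunctions with zero eigenvalue of the relative Hamiltonian (m_1²/(q+μ)) e^{2μ∂_q} − (m_2²/(q−μ)) e^{−2μ∂_q} of the n = 2 Ruijsenaars-type quantum integrable system constructed in the paper. -/
noncomputable section

namespace Paper

open Complex

/-- The common prefactor
`Γ((q+μ)/(4μ) + 1/2) / Γ((q+μ)/(4μ)) · exp(-(q/(2μ)) ln(m₁/m₂))`. -/
def pref (μ : ℂ) (m1 m2 : ℝ) (q : ℂ) : ℂ :=
  (Complex.Gamma ((q + μ) / (4 * μ) + 1 / 2) / Complex.Gamma ((q + μ) / (4 * μ))) *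
    Complex.exp (-(q / (2 * μ)) * (Real.log (m1 / m2) : ℂ))

/-- `ψ_k(q)`, the odd zero-eigenvalue eigenfunction. -/
def ψ (μ : ℂ) (m1 m2 : ℝ) (k : ℕ) (q : ℂ) : ℂ :=
  pref μ m1 m2 q * Complex.sin ((k : ℂ) * (Real.pi : ℂ) * q / μ)

/-- `φ_k(q)`, the even zero-eigenvalue eigenfunction. -/
def φ (μ : ℂ) (m1 m2 : ℝ) (k : ℕ) (q : ℂ) : ℂ :=
  pref μ m1 m2 q * Complex.cos ((k : ℂ) * (Real.pi : ℂ) * q / μ)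

/-- The prefactor satisfies the zero-eigenvalue difference equation. -/
theorem pref_shift (μ : ℂ) (hμ : μ ≠ 0) (m1 m2 : ℝ) (hm1 : 0 < m1) (hm2 : 0 < m2) (q : ℂ)
    (hz : (q + μ) / (4 * μ) ≠ 0) (hz' : (q + μ) / (4 * μ) - 1 / 2 ≠ 0) :
    ((m1 : ℂ) ^ 2 / (q + μ)) * pref μ m1 m2 (q + 2 * μ) =
      ((m2 : ℂ) ^ 2 / (q - μ)) * pref μ m1 m2 (q - 2 * μ) := by
  obtain ⟨z, rfl⟩ : ∃ z, q = 4 * μ * z - μ := ⟨(q + μ) / (4 * μ), by field_simp; ring⟩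
  have e0 : (4 * μ * z - μ + μ) / (4 * μ) = z := by field_simp; ring
  rw [e0] at hz hz'
  have e1 : (4 * μ * z - μ + 2 * μ + μ) / (4 * μ) = z + 1 / 2 := by field_simp; ring
  have e2 : (4 * μ * z - μ - 2 * μ + μ) / (4 * μ) = z - 1 / 2 := by field_simp; ring
  have e3 : -((4 * μ * z - μ + 2 * μ) / (2 * μ)) * (Real.log (m1 / m2) : ℂ) =
      -((4 * μ * z - μ) / (2 * μ)) * (Real.log (m1 / m2) : ℂ) - (Real.log (m1 / m2) : ℂ) := by
    field_simp; ring
  have e4 : -((4 * μ * z - μ - 2 * μ) / (2 * μ)) * (Real.log (m1 / m2) : ℂ) =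
      -((4 * μ * z - μ) / (2 * μ)) * (Real.log (m1 / m2) : ℂ) + (Real.log (m1 / m2) : ℂ) := by
    field_simp; ring
  have hexp : Complex.exp (Real.log (m1 / m2) : ℂ) = (m1 : ℂ) / m2 := by
    rw [← Complex.ofReal_exp, Real.exp_log (div_pos hm1 hm2), Complex.ofReal_div]
  have g1 : Complex.Gamma (z + 1 / 2 + 1 / 2) = z * Complex.Gamma z := by
    rw [← Complex.Gamma_add_one z hz]; congr 1; ring
  have g2 : Complex.Gamma (z + 1 / 2) = (z - 1 / 2) * Complex.Gamma (z - 1 / 2) := by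
    rw [← Complex.Gamma_add_one _ hz']; congr 1; ring
  have hm1' : (m1 : ℂ) ≠ 0 := by exact_mod_cast hm1.ne'
  have hm2' : (m2 : ℂ) ≠ 0 := by exact_mod_cast hm2.ne'
  have e6 : 4 * μ * z - μ - μ = 4 * μ * (z - 1 / 2) := by ring
  unfold pref
  rw [e1, e2, e3, e4, Complex.exp_sub, Complex.exp_add, hexp, g1, g2, e6]
  simp only [sub_add_cancel]
  generalize z - 1 / 2 = w at *
  generalize Complex.exp _ = E
  simp only [div_eq_mul_inv, mul_inv, inv_inv]
  field_simp

/-- The functions `ψ_k` and `φ_k` are zero-eigenvalue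
eigenfunctions of the relative Hamiltonian
`(m₁²/(q+μ)) e^{2μ∂_q} - (m₂²/(q-μ)) e^{-2μ∂_q}` of the `n = 2`
Ruijsenaars-type system: for every `q` such that none of `(q+μ)/(4μ)`,
`(q+μ)/(4μ) + 1/2`, `(q+μ)/(4μ) - 1/2` is a nonpositive integer,
`(m₁²/(q+μ)) ψ(q+2μ) = (m₂²/(q-μ)) ψ(q-2μ)`, and likewise for `φ`. -/
theorem statement19 (μ : ℂ) (hμ : μ ≠ 0) (m1 m2 : ℝ) (hm1 : 0 < m1) (hm2 : 0 < m2)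
    (k : ℕ) :
    ∀ q : ℂ,
      (∀ m : ℤ, m ≤ 0 →
        (q + μ) / (4 * μ) ≠ (m : ℂ) ∧
        (q + μ) / (4 * μ) + 1 / 2 ≠ (m : ℂ) ∧
        (q + μ) / (4 * μ) - 1 / 2 ≠ (m : ℂ)) →
      ((m1 : ℂ) ^ 2 / (q + μ)) * ψ μ m1 m2 k (q + 2 * μ) =
          ((m2 : ℂ) ^ 2 / (q - μ)) * ψ μ m1 m2 k (q - 2 * μ) ∧
      ((m1 : ℂ) ^ 2 / (q + μ)) * φ μ m1 m2 k (q + 2 * μ) =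
          ((m2 : ℂ) ^ 2 / (q - μ)) * φ μ m1 m2 k (q - 2 * μ) := by
  intro q hq
  obtain ⟨h0, -, h2⟩ := hq 0 le_rfl
  have key := pref_shift μ hμ m1 m2 hm1 hm2 q (by simpa using h0) (by simpa using h2)
  have a1 : (k : ℂ) * (Real.pi : ℂ) * (q + 2 * μ) / μ =
      (k : ℂ) * (Real.pi : ℂ) * q / μ + k * (2 * Real.pi) := by
    field_simp
  have a2 : (k : ℂ) * (Real.pi : ℂ) * (q - 2 * μ) / μ =
      (k : ℂ) * (Real.pi : ℂ) * q / μ - k * (2 * Real.pi) := by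
    field_simp
  unfold ψ φ
  rw [a1, a2, Complex.sin_add_nat_mul_two_pi, Complex.sin_sub_nat_mul_two_pi,
    Complex.cos_add_nat_mul_two_pi, Complex.cos_sub_nat_mul_two_pi]
  simp only [← mul_assoc, key, and_self]

end Paper

end
end
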